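/- Let X be a Banach space having Azuma type p with constant K (1 < p ≤ 2). Then for every X-valued conditionally symmetric martingale f = (f_j)_{j≥0}, every β > 0, every 0 < δ < β − 1, and every λ > 0, the following good-λ inequality holds: P(f* > βλ and S_p(f) ≤ δλ) ≤ 2·exp(−(β−1−δ)^p/(K·δ^p))·P(f* > λ). -/

import Mathlib

open MeasureTheory
open scoped ENNReal NNReal

/-- A martingale (given by its sequence `f`) is conditionally symmetric: for every `j ≥ 1`
and every bounded continuous `φ : X^j → ℝ`,
`E φ(d_1,…,d_{j−1},d_j) = E φ(d_1,…,d_{j−1},−d_j)`, where `d_k = f_k − f_{k−1}`. -/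
def CondSymmetric {Ω : Type*} [MeasurableSpace Ω] (μ : Measure Ω)
    {X : Type*} [NormedAddCommGroup X] (f : ℕ → Ω → X) : Prop :=
  ∀ j : ℕ, ∀ φ : (Fin (j + 1) → X) → ℝ, Continuous φ → (∃ C, ∀ v, |φ v| ≤ C) →
    (∫ ω, φ (fun i => f ((i : ℕ) + 1) ω - f (i : ℕ) ω) ∂μ) =
    (∫ ω, φ (fun i => if (i : ℕ) = j then -(f ((i : ℕ) + 1) ω - f (i : ℕ) ω)
        else f ((i : ℕ) + 1) ω - f (i : ℕ) ω) ∂μ)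

/-- A Banach space `X` has Azuma type `p` with constant `K` if for every `X`-valued
martingale `f` (on any filtered probability space with trivial initial σ-algebra) and every
nonnegative predictable sequence `w` dominating the martingale differences a.s., one has
`P(f* ≥ r) ≤ 2·exp(−r^p/(K·‖Σ_j w_j^p‖_∞))` for all `r > 0`. -/
def HasAzumaType (X : Type*) [NormedAddCommGroup X] [NormedSpace ℝ X] [CompleteSpace X]
    (p K : ℝ) : Prop :=
  ∀ (Ω : Type) (m : MeasurableSpace Ω) (μ : Measure Ω), IsProbabilityMeasure μ →
    ∀ ℱ : Filtration ℕ m, ℱ 0 = ⊥ →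
    ∀ f : ℕ → Ω → X, Martingale f ℱ μ →
    ∀ w : ℕ → Ω → ℝ, (∀ j ω, 0 ≤ w (j + 1) ω) →
      (∀ j : ℕ, StronglyMeasurable[ℱ j] (w (j + 1))) →
      (∀ j : ℕ, ∀ᵐ ω ∂μ, ‖f (j + 1) ω - f j ω‖ ≤ w (j + 1) ω) →
      ∀ r : ℝ, 0 < r →
        μ {ω | ENNReal.ofReal r ≤ ⨆ j : ℕ, (‖f (j + 1) ω - f 0 ω‖₊ : ℝ≥0∞)}
          ≤ ENNReal.ofReal (2 * Real.exp (-(r ^ p) /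
              (K * (essSup (fun ω => ∑' j : ℕ, ENNReal.ofReal (w (j + 1) ω ^ p)) μ).toReal)))

set_option linter.unusedSectionVars false
set_option linter.style.haveILetI false

namespace GoodLambda

variable {Ω X : Type*} [NormedAddCommGroup X]

/-- The vector of the first `j+1` differences. -/
def V (d : ℕ → Ω → X) (j : ℕ) (ω : Ω) : Fin (j + 1) → X := fun i => d i ω

/-- Sign flip of the last coordinate. -/
def R (j : ℕ) (v : Fin (j + 1) → X) : Fin (j + 1) → X :=
  fun i => if (i : ℕ) = j then - v i else v i

/-- The σ-algebra generated by `d 0, …, d (j-1)` and `d j` up to sign. -/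
@[reducible]
def G (d : ℕ → Ω → X) (j : ℕ) : MeasurableSpace Ω :=
  (@MeasurableSpace.invariants (Fin (j + 1) → X) (borel _) (R j)).comap (V d j)

lemma continuous_R (j : ℕ) : Continuous (R j : (Fin (j + 1) → X) → _) := by
  refine continuous_pi fun i => ?_
  unfold R
  split_ifs
  · exact (continuous_apply i).neg
  · exact continuous_apply i

lemma measurable_G {Z : Type*} [TopologicalSpace Z] [mZ : MeasurableSpace Z] [BorelSpace Z]
    (d : ℕ → Ω → X) (j : ℕ) (h : (Fin (j + 1) → X) → Z) (hc : Continuous h)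
    (hR : ∀ v, h (R j v) = h v) : Measurable[G d j] (fun ω => h (V d j ω)) := by
  intro s hs
  refine ⟨h ⁻¹' s, ⟨?_, ?_⟩, rfl⟩
  · have : @Measurable _ _ (borel _) mZ h := by
      letI : MeasurableSpace (Fin (j + 1) → X) := borel _
      haveI : BorelSpace (Fin (j + 1) → X) := ⟨rfl⟩
      exact hc.measurable
    exact this hs
  · ext v
    simp [hR]

lemma G_mono (d : ℕ → Ω → X) : Monotone (G d) := by
  refine monotone_nat_of_le_succ fun j => ?_
  rintro s ⟨B, ⟨hB, hBR⟩, rfl⟩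
  refine ⟨(fun v : Fin (j + 1 + 1) → X => fun i : Fin (j + 1) => v i.castSucc) ⁻¹' B, ⟨?_, ?_⟩, rfl⟩
  · letI : MeasurableSpace (Fin (j + 1) → X) := borel _
    haveI : BorelSpace (Fin (j + 1) → X) := ⟨rfl⟩
    letI : MeasurableSpace (Fin (j + 1 + 1) → X) := borel _
    haveI : BorelSpace (Fin (j + 1 + 1) → X) := ⟨rfl⟩
    have : Continuous (fun v : Fin (j + 1 + 1) → X => fun i : Fin (j + 1) => v i.castSucc) := by
      fun_prop
    exact this.measurable hB
  · ext v
    have : (fun i : Fin (j + 1) => R (j + 1) v i.castSucc) = fun i => v i.castSucc := by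
      ext i
      have := i.2
      simp only [R, Fin.val_castSucc]
      rw [if_neg (by omega)]
    simp [this]

variable {m : MeasurableSpace Ω}

lemma stronglyMeasurable_V {d : ℕ → Ω → X} (hd : ∀ j, StronglyMeasurable (d j)) (j : ℕ) :
    StronglyMeasurable (V d j) := by
  have : V d j = ∑ i : Fin (j + 1), fun ω => Pi.single i (d i ω) := by
    ext ω k
    simp [V, Finset.sum_apply, Pi.single_apply]
  rw [this]
  refine Finset.stronglyMeasurable_sum _ fun i _ => ?_
  exact (continuous_single i).comp_stronglyMeasurable (hd i)

lemma measurable_V {d : ℕ → Ω → X} (hd : ∀ j, StronglyMeasurable (d j)) (j : ℕ) :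
    @Measurable _ _ m (borel _) (V d j) := by
  letI : MeasurableSpace (Fin (j + 1) → X) := borel _
  haveI : BorelSpace (Fin (j + 1) → X) := ⟨rfl⟩
  exact (stronglyMeasurable_V hd j).measurable

lemma G_le {d : ℕ → Ω → X} (hd : ∀ j, StronglyMeasurable (d j)) (j : ℕ) : G d j ≤ m := by
  rintro s ⟨B, ⟨hB, hBR⟩, rfl⟩
  exact measurable_V hd j hB

lemma stronglyMeasurable_G {d : ℕ → Ω → X} (hd : ∀ j, StronglyMeasurable (d j)) {i j : ℕ}
    (hij : i < j) : StronglyMeasurable[G d j] (d i) := by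
  letI : MeasurableSpace X := borel X
  haveI : BorelSpace X := ⟨rfl⟩
  rw [stronglyMeasurable_iff_measurable_separable]
  refine ⟨?_, (hd i).isSeparable_range⟩
  have := measurable_G d j (fun v => v ⟨i, by omega⟩) (continuous_apply _) (by
    intro v; simp [R]; omega)
  exact this

lemma stronglyMeasurable_norm_G (d : ℕ → Ω → X) {i j : ℕ}
    (hij : i ≤ j) : StronglyMeasurable[G d j] (fun ω => ‖d i ω‖) := by
  have := measurable_G d j (fun v => ‖v ⟨i, by omega⟩‖) (continuous_apply _).norm (by
    intro v; simp only [R]; split_ifs <;> simp)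
  exact this.stronglyMeasurable

/-- symmetry in terms of differences -/
def Symm (μ : Measure Ω) (d : ℕ → Ω → X) : Prop :=
  ∀ j : ℕ, ∀ φ : (Fin (j + 1) → X) → ℝ, Continuous φ → (∃ C, ∀ v, |φ v| ≤ C) →
    (∫ ω, φ (V d j ω) ∂μ) = (∫ ω, φ (R j (V d j ω)) ∂μ)

lemma setIntegral_eq_zero [NormedSpace ℝ X] [CompleteSpace X] {μ : Measure Ω}
    [IsProbabilityMeasure μ] {d : ℕ → Ω → X} (hd : ∀ j, StronglyMeasurable (d j))
    (hi : ∀ j, Integrable (d j) μ) (hs : Symm μ d) (j : ℕ) {A : Set Ω}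
    (hA : MeasurableSet[G d j] A) : ∫ ω in A, d j ω ∂μ = 0 := by
  refine SeparatingDual.eq_zero_of_forall_dual_eq_zero (R := ℝ) fun ℓ => ?_
  rw [← ContinuousLinearMap.integral_comp_comm _ (hi j).integrableOn]
  have hAm := G_le hd j _ hA
  obtain ⟨B, ⟨hB, hBR⟩, rfl⟩ := hA
  letI : MeasurableSpace (Fin (j + 1) → X) := borel _
  haveI : BorelSpace (Fin (j + 1) → X) := ⟨rfl⟩
  have hV : Measurable (V d j) := measurable_V hd j
  have hR : Measurable (R j : (Fin (j + 1) → X) → _) := (continuous_R j).measurable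
  have key : μ.map (V d j) = μ.map (R j ∘ V d j) := by
    haveI := Measure.isProbabilityMeasure_map (μ := μ) hV.aemeasurable
    haveI := Measure.isProbabilityMeasure_map (μ := μ) (hR.comp hV).aemeasurable
    refine ext_of_forall_integral_eq_of_IsFiniteMeasure fun φ => ?_
    have hφ := φ.continuous.measurable.stronglyMeasurable
    rw [integral_map hV.aemeasurable hφ.aestronglyMeasurable,
      integral_map (hR.comp hV).aemeasurable hφ.aestronglyMeasurable]
    exact hs j φ φ.continuous ⟨‖φ‖, fun v => φ.norm_coe_le_norm v⟩
  have hψ : Measurable (B.indicator (fun v : Fin (j + 1) → X => ℓ (v (Fin.last j)))) :=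
    (ℓ.continuous.comp (continuous_apply _)).measurable.indicator hB
  have h1 := integral_map (μ := μ) hV.aemeasurable hψ.stronglyMeasurable.aestronglyMeasurable
  have h2 := integral_map (μ := μ) (hR.comp hV).aemeasurable
    hψ.stronglyMeasurable.aestronglyMeasurable
  rw [← key, h1] at h2
  rw [← integral_indicator hAm]
  have e1 : ∀ ω, B.indicator (fun v : Fin (j + 1) → X => ℓ (v (Fin.last j))) (V d j ω)
      = (V d j ⁻¹' B).indicator (fun ω => ℓ (d j ω)) ω := by
    intro ω
    rfl
  have e2 : ∀ ω, B.indicator (fun v : Fin (j + 1) → X => ℓ (v (Fin.last j))) ((R j ∘ V d j) ω)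
      = - (V d j ⁻¹' B).indicator (fun ω => ℓ (d j ω)) ω := by
    intro ω
    have : R j (V d j ω) ∈ B ↔ V d j ω ∈ B := by
      rw [← Set.mem_preimage, hBR]
    rw [Function.comp_apply]
    by_cases h : V d j ω ∈ B
    · rw [Set.indicator_of_mem (s := V d j ⁻¹' B) h, Set.indicator_of_mem (this.2 h)]
      simp [R, V]
    · rw [Set.indicator_of_notMem (s := V d j ⁻¹' B) h, Set.indicator_of_notMem (mt this.1 h)]
      simp
  simp_rw [e1, e2] at h2
  rw [integral_neg] at h2
  linarith

/-- The event that the p-th power sum up to index `j` is at most `c`. -/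
def U (d : ℕ → Ω → X) (p c : ℝ) (j : ℕ) : Set Ω :=
  {ω | ∑ i ∈ Finset.range (j + 1), ‖d i ω‖ ^ p ≤ c}

/-- Stopped differences. -/
noncomputable def u (d : ℕ → Ω → X) (p c : ℝ) (j : ℕ) : Ω → X := (U d p c j).indicator (d j)

lemma measurableSet_U (d : ℕ → Ω → X) (p c : ℝ) (j : ℕ) : MeasurableSet[G d j] (U d p c j) := by
  have : Measurable[G d j] (fun ω => ∑ i ∈ Finset.range (j + 1), ‖d i ω‖ ^ p) := by
    refine Finset.measurable_fun_sum _ fun i hi => ?_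
    exact (stronglyMeasurable_norm_G d (by simp at hi; omega)).measurable.pow_const p
  exact this measurableSet_Iic

lemma norm_u_le (d : ℕ → Ω → X) (p c : ℝ) (j : ℕ) (ω : Ω) : ‖u d p c j ω‖ ≤ ‖d j ω‖ :=
  norm_indicator_le_norm_self _ _

lemma sum_u_le (d : ℕ → Ω → X) {p c : ℝ} (hp : 0 < p) (hc : 0 ≤ c) (N : ℕ) (ω : Ω) :
    ∑ i ∈ Finset.range N, ‖u d p c i ω‖ ^ p ≤ c := by
  induction N with
  | zero => simpa
  | succ N ih =>
    by_cases h : ω ∈ U d p c N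
    · refine le_trans (Finset.sum_le_sum fun i _ => ?_) h
      exact Real.rpow_le_rpow (norm_nonneg _) (norm_u_le ..) hp.le
    · rw [Finset.sum_range_succ]
      simpa [u, h, Real.zero_rpow hp.ne'] using ih

lemma stronglyMeasurable_u {d : ℕ → Ω → X} (hd : ∀ j, StronglyMeasurable (d j)) (p c : ℝ)
    {i j : ℕ} (hij : i < j) : StronglyMeasurable[G d j] (u d p c i) :=
  (stronglyMeasurable_G hd hij).indicator (G_mono d hij.le _ (measurableSet_U d p c i))

lemma stronglyMeasurable_norm_u (d : ℕ → Ω → X) (p c : ℝ)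
    (j : ℕ) : StronglyMeasurable[G d j] (fun ω => ‖u d p c j ω‖) := by
  have : (fun ω => ‖u d p c j ω‖) = (U d p c j).indicator (fun ω => ‖d j ω‖) := by
    ext ω
    simp [u, norm_indicator_eq_indicator_norm]
  rw [this]
  exact (stronglyMeasurable_norm_G d le_rfl).indicator (measurableSet_U d p c j)

/-- The shifted filtration. -/
def H {d : ℕ → Ω → X} (hd : ∀ j, StronglyMeasurable (d j)) (k : ℕ) : Filtration ℕ m where
  seq n := match n with
    | 0 => ⊥
    | n + 1 => G d (k + n)
  mono' := by
    refine monotone_nat_of_le_succ fun n => ?_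
    cases n with
    | zero => exact bot_le
    | succ n => exact G_mono d (by omega)
  le' n := by
    cases n with
    | zero => exact bot_le
    | succ n => exact G_le hd _

/-- The stopped and shifted martingale. -/
noncomputable def g (d : ℕ → Ω → X) (p c : ℝ) (k n : ℕ) (ω : Ω) : X :=
  ∑ i ∈ Finset.range (n - 1), u d p c (k + i) ω

variable [NormedSpace ℝ X] [CompleteSpace X]

lemma martingale_g {μ : Measure Ω} [IsProbabilityMeasure μ]
    {d : ℕ → Ω → X} (hd : ∀ j, StronglyMeasurable (d j))
    (hi : ∀ j, Integrable (d j) μ) (hs : Symm μ d) (p c : ℝ) (k : ℕ) (E : Set Ω)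
    (hE : MeasurableSet[G d k] E) (hE0 : μ E ≠ 0) :
    Martingale (g d p c k) (H hd k) (ProbabilityTheory.cond μ E) := by
  haveI := ProbabilityTheory.cond_isProbabilityMeasure hE0
  have hiu : ∀ j, Integrable (u d p c j) (ProbabilityTheory.cond μ E) := by
    intro j
    refine Integrable.smul_measure ?_ (by simp [hE0])
    exact ((hi j).indicator (G_le hd _ _ (measurableSet_U d p c j))).restrict
  have hig : ∀ n, Integrable (g d p c k n) (ProbabilityTheory.cond μ E) := fun n =>
    integrable_finsetSum _ fun i _ => hiu _
  refine martingale_of_setIntegral_eq_succ ?_ ?_ ?_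
  · intro n
    cases n with
    | zero =>
      have : g d p c k 0 = fun _ => 0 := by
        ext ω
        simp [g]
      rw [this]
      exact stronglyMeasurable_const
    | succ n =>
      change StronglyMeasurable[G d (k + n)] _
      refine Finset.stronglyMeasurable_fun_sum _ fun i hi => ?_
      exact stronglyMeasurable_u hd p c (by simp at hi; omega)
  · exact hig
  · intro n A hA
    cases n with
    | zero => simp [g]
    | succ n =>
      change MeasurableSet[G d (k + n)] A at hA
      have hAm := G_le hd _ _ hA
      have : ∀ ω, g d p c k (n + 1 + 1) ω = g d p c k (n + 1) ω + u d p c (k + n) ω := by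
        intro ω
        simp [g, Finset.sum_range_succ]
      simp_rw [this]
      rw [integral_add (hig _).integrableOn
        (hiu _).integrableOn]
      have hEk : MeasurableSet[G d (k + n)] E := G_mono d (by omega) _ hE
      have hU := measurableSet_U d p c (k + n)
      have h0 : ∫ ω in A, u d p c (k + n) ω ∂(ProbabilityTheory.cond μ E) = 0 := by
        rw [ProbabilityTheory.cond, Measure.restrict_smul, integral_smul_measure,
          Measure.restrict_restrict hAm]
        unfold u
        rw [setIntegral_indicator (G_le hd _ _ hU),
          setIntegral_eq_zero hd hi hs (k + n) ((hA.inter hEk).inter hU), smul_zero]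
      rw [h0, add_zero]

/-- The predictable dominating sequence. -/
noncomputable def w (d : ℕ → Ω → X) (p c : ℝ) (k : ℕ) : ℕ → Ω → ℝ
  | 0 => fun _ => 0
  | 1 => fun _ => 0
  | n + 2 => fun ω => ‖u d p c (k + n) ω‖

lemma tsum_w_le (d : ℕ → Ω → X) {p c : ℝ} (hp : 0 < p) (hc : 0 ≤ c) (k : ℕ) (ω : Ω) :
    ∑' j : ℕ, ENNReal.ofReal (w d p c k (j + 1) ω ^ p) ≤ ENNReal.ofReal c := by
  rw [ENNReal.tsum_eq_iSup_nat]
  refine iSup_le fun N => ?_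
  have hnn : ∀ j, 0 ≤ w d p c k (j + 1) ω ^ p := by
    intro j
    cases j with
    | zero => simp [w, Real.zero_rpow hp.ne']
    | succ j => exact Real.rpow_nonneg (norm_nonneg _) _
  rw [← ENNReal.ofReal_sum_of_nonneg fun j _ => hnn j]
  refine ENNReal.ofReal_le_ofReal ?_
  calc ∑ j ∈ Finset.range N, w d p c k (j + 1) ω ^ p
      ≤ ∑ j ∈ Finset.range (N + 1), w d p c k (j + 1) ω ^ p := by
        rw [Finset.sum_range_succ]
        linarith [hnn N]
    _ = ∑ j ∈ Finset.range N, ‖u d p c (k + j) ω‖ ^ p := by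
        rw [Finset.sum_range_succ']
        simp [w, Real.zero_rpow hp.ne']
    _ ≤ ∑ i ∈ Finset.range (k + N), ‖u d p c i ω‖ ^ p := by
        rw [Finset.sum_range_add]
        have : 0 ≤ ∑ i ∈ Finset.range k, ‖u d p c i ω‖ ^ p :=
          Finset.sum_nonneg fun i _ => Real.rpow_nonneg (norm_nonneg _) _
        linarith
    _ ≤ c := sum_u_le d hp hc _ ω

lemma azuma_step {Ω : Type} {m : MeasurableSpace Ω} {μ : Measure Ω} [IsProbabilityMeasure μ]
    {d : ℕ → Ω → X} (hd : ∀ j, StronglyMeasurable (d j))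
    (hi : ∀ j, Integrable (d j) μ) (hs : Symm μ d) {p K c r : ℝ} (hp : 0 < p) (hK : 0 < K)
    (hX : HasAzumaType X p K) (hc : 0 < c) (hr : 0 < r) (k : ℕ) (E : Set Ω)
    (hE : MeasurableSet[G d k] E) (hE0 : μ E ≠ 0) :
    ProbabilityTheory.cond μ E
      {ω | ENNReal.ofReal r ≤ ⨆ j : ℕ, (‖g d p c k (j + 1) ω - g d p c k 0 ω‖₊ : ℝ≥0∞)}
      ≤ ENNReal.ofReal (2 * Real.exp (-(r ^ p) / (K * c))) := by
  haveI := ProbabilityTheory.cond_isProbabilityMeasure hE0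
  have hstep : ∀ n ω, g d p c k (n + 1 + 1) ω = g d p c k (n + 1) ω + u d p c (k + n) ω := by
    intro n ω
    simp [g, Finset.sum_range_succ]
  have main := hX Ω m (ProbabilityTheory.cond μ E) inferInstance (H hd k) rfl (g d p c k)
    (martingale_g hd hi hs p c k E hE hE0) (w d p c k) (by
      intro j ω
      cases j with
      | zero => exact le_rfl
      | succ j => exact norm_nonneg _) (by
      intro j
      cases j with
      | zero => exact stronglyMeasurable_const
      | succ j => exact stronglyMeasurable_norm_u d p c (k + j)) (by
      intro j
      refine ae_of_all _ fun ω => ?_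
      cases j with
      | zero => simp [g, w]
      | succ j =>
        rw [hstep, add_sub_cancel_left]
        exact le_rfl) r hr
  set M := essSup (fun ω => ∑' j : ℕ, ENNReal.ofReal (w d p c k (j + 1) ω ^ p))
    (ProbabilityTheory.cond μ E) with hM
  have hMc : M ≤ ENNReal.ofReal c :=
    essSup_le_of_ae_le _ (ae_of_all _ fun ω => tsum_w_le d hp hc.le k ω)
  by_cases hM0 : M = 0
  · rw [hM, ENNReal.essSup_eq_zero_iff] at hM0
    have : ProbabilityTheory.cond μ E
      {ω | ENNReal.ofReal r ≤ ⨆ j : ℕ, (‖g d p c k (j + 1) ω - g d p c k 0 ω‖₊ : ℝ≥0∞)} = 0 := by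
      refine measure_mono_null ?_ (ae_iff.1 hM0)
      intro ω hω
      rw [Set.mem_ofPred_eq]
      intro h0
      simp only [Pi.zero_apply, ENNReal.tsum_eq_zero] at h0
      have hu : ∀ i, u d p c (k + i) ω = 0 := by
        intro i
        have := h0 (i + 1)
        rw [ENNReal.ofReal_eq_zero] at this
        have h1 : ‖u d p c (k + i) ω‖ ^ p = 0 :=
          le_antisymm this (Real.rpow_nonneg (norm_nonneg _) _)
        rw [Real.rpow_eq_zero (norm_nonneg _) hp.ne'] at h1
        simpa using h1
      simp only [Set.mem_ofPred_eq, g, hu] at hω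
      simp at hω
      linarith
    rw [this]
    exact zero_le
  · refine main.trans (ENNReal.ofReal_le_ofReal ?_)
    have hMt : M ≠ ∞ := (hMc.trans_lt ENNReal.ofReal_lt_top).ne
    have h1 : 0 < M.toReal := ENNReal.toReal_pos hM0 hMt
    have h2 : M.toReal ≤ c := ENNReal.toReal_le_of_le_ofReal hc.le hMc
    have h3 : 0 ≤ r ^ p := Real.rpow_nonneg hr.le _
    refine mul_le_mul_of_nonneg_left (Real.exp_le_exp.2 ?_) zero_le_two
    rw [neg_div, neg_div]
    refine neg_le_neg ?_
    gcongr

/-- Event that the partial sums first exceed `l` at time `k`. -/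
def E (d : ℕ → Ω → X) (l : ℝ) (k : ℕ) : Set Ω :=
  {ω | (∀ i < k, ‖∑ a ∈ Finset.range i, d a ω‖ ≤ l) ∧ l < ‖∑ a ∈ Finset.range k, d a ω‖}

lemma measurableSet_E {d : ℕ → Ω → X} (hd : ∀ j, StronglyMeasurable (d j)) (l : ℝ) (k : ℕ) :
    MeasurableSet[G d k] (E d l k) := by
  have h : ∀ i ≤ k, Measurable[G d k] (fun ω => ‖∑ a ∈ Finset.range i, d a ω‖) := by
    intro i hi
    have : StronglyMeasurable[G d k] (fun ω => ∑ a ∈ Finset.range i, d a ω) :=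
      Finset.stronglyMeasurable_fun_sum _ fun a ha =>
        stronglyMeasurable_G hd (by simp at ha; omega)
    exact this.norm.measurable
  have : E d l k = (⋂ i, ⋂ (_ : i < k), {ω | ‖∑ a ∈ Finset.range i, d a ω‖ ≤ l}) ∩
      {ω | l < ‖∑ a ∈ Finset.range k, d a ω‖} := by
    ext ω
    simp [E]
  rw [this]
  refine MeasurableSet.inter ?_ (h k le_rfl measurableSet_Ioi)
  exact MeasurableSet.iInter fun i => MeasurableSet.iInter fun hi => h i hi.le measurableSet_Iic

lemma block {Ω : Type} {m : MeasurableSpace Ω} {μ : Measure Ω} [IsProbabilityMeasure μ]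
    {d : ℕ → Ω → X} (hd : ∀ j, StronglyMeasurable (d j))
    (hi : ∀ j, Integrable (d j) μ) (hs : Symm μ d) {p K : ℝ} (hp : 0 < p) (hK : 0 < K)
    (hX : HasAzumaType X p K)
    {β δ l : ℝ} (hδ0 : 0 < δ) (hδ : δ < β - 1) (hl : 0 < l) (k : ℕ) :
    μ (E d l k ∩ {ω | (∃ n, β * l < ‖∑ a ∈ Finset.range n, d a ω‖) ∧
        ∀ n, ∑ a ∈ Finset.range n, ‖d a ω‖ ^ p ≤ (δ * l) ^ p})
      ≤ ENNReal.ofReal (2 * Real.exp (-((β - 1 - δ) ^ p) / (K * δ ^ p))) * μ (E d l k) := by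
  by_cases hE0 : μ (E d l k) = 0
  · rw [hE0, mul_zero]
    exact (measure_mono Set.inter_subset_left).trans hE0.le
  have hEm := G_le hd _ _ (measurableSet_E hd l k)
  have hb : 0 < β - 1 - δ := by linarith
  have hdl : 0 < δ * l := by positivity
  have hstep := azuma_step hd hi hs hp hK hX (c := (δ * l) ^ p) (r := (β - 1 - δ) * l)
    (by positivity) (by positivity) k (E d l k) (measurableSet_E hd l k) hE0
  rw [ProbabilityTheory.cond_apply hEm] at hstep
  have hconst : -(((β - 1 - δ) * l) ^ p) / (K * (δ * l) ^ p)
      = -((β - 1 - δ) ^ p) / (K * δ ^ p) := by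
    rw [Real.mul_rpow hb.le hl.le, Real.mul_rpow hδ0.le hl.le]
    have : 0 < l ^ p := by positivity
    have : 0 < δ ^ p := by positivity
    field_simp
  rw [hconst] at hstep
  rw [ENNReal.inv_mul_le_iff hE0 (measure_ne_top _ _), mul_comm (μ (E d l k))] at hstep
  refine le_trans (measure_mono ?_) hstep
  rintro ω ⟨hω, ⟨N, hN⟩, hS⟩
  refine ⟨hω, ?_⟩
  have hβl : l + δ * l < β * l := by nlinarith
  have hkN : k ≤ N := by
    by_contra h
    have := hω.1 N (by omega)
    linarith
  obtain ⟨n, rfl⟩ := Nat.exists_eq_add_of_le hkN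
  have hk1 : ∃ k', k = k' + 1 := by
    cases k with
    | zero =>
      have := hω.2
      simp at this
      linarith
    | succ k => exact ⟨k, rfl⟩
  have hu : ∀ j, u d p ((δ * l) ^ p) j ω = d j ω := by
    intro j
    exact Set.indicator_of_mem (s := U d p ((δ * l) ^ p) j) (hS (j + 1)) _
  have hk : ‖∑ a ∈ Finset.range k, d a ω‖ ≤ l + δ * l := by
    obtain ⟨k', rfl⟩ := hk1
    rw [Finset.sum_range_succ]
    refine (norm_add_le _ _).trans (add_le_add (hω.1 k' (by omega)) ?_)
    have h1 : ‖d k' ω‖ ^ p ≤ (δ * l) ^ p := by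
      refine le_trans ?_ (hS (k' + 1))
      rw [Finset.sum_range_succ]
      have : 0 ≤ ∑ i ∈ Finset.range k', ‖d i ω‖ ^ p :=
          Finset.sum_nonneg fun i _ => Real.rpow_nonneg (norm_nonneg _) _
      linarith
    exact (Real.rpow_le_rpow_iff (norm_nonneg _) hdl.le hp).1 h1
  rw [Set.mem_ofPred_eq]
  refine le_iSup_of_le n ?_
  have hg : g d p ((δ * l) ^ p) k (n + 1) ω - g d p ((δ * l) ^ p) k 0 ω
      = ∑ a ∈ Finset.range (k + n), d a ω - ∑ a ∈ Finset.range k, d a ω := by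
    rw [Finset.sum_range_add]
    simp [g, hu]
  rw [hg, ← enorm_eq_nnnorm, ← ofReal_norm]
  refine ENNReal.ofReal_le_ofReal ?_
  have := norm_sub_norm_le (∑ a ∈ Finset.range (k + n), d a ω) (∑ a ∈ Finset.range k, d a ω)
  nlinarith

lemma lt_iSup_iff' (s : ℕ → X) (hs0 : s 0 = 0) {l : ℝ} (hl : 0 ≤ l) :
    ENNReal.ofReal l < (⨆ j : ℕ, (‖s (j + 1)‖₊ : ℝ≥0∞)) ↔ ∃ n, l < ‖s n‖ := by
  rw [lt_iSup_iff]
  have : ∀ n, ENNReal.ofReal l < (‖s n‖₊ : ℝ≥0∞) ↔ l < ‖s n‖ := by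
    intro n
    rw [← enorm_eq_nnnorm, ← ofReal_norm]
    exact ENNReal.ofReal_lt_ofReal_iff_of_nonneg hl
  simp_rw [this]
  constructor
  · rintro ⟨j, hj⟩
    exact ⟨_, hj⟩
  · rintro ⟨n, hn⟩
    cases n with
    | zero =>
      rw [hs0, norm_zero] at hn
      linarith
    | succ n => exact ⟨n, hn⟩

lemma good_sums {Ω : Type} {m : MeasurableSpace Ω} {μ : Measure Ω} [IsProbabilityMeasure μ]
    {d : ℕ → Ω → X} (hd : ∀ j, StronglyMeasurable (d j))
    (hi : ∀ j, Integrable (d j) μ) (hs : Symm μ d) {p K : ℝ} (hp : 0 < p) (hK : 0 < K)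
    (hX : HasAzumaType X p K)
    {β δ l : ℝ} (hδ0 : 0 < δ) (hδ : δ < β - 1) (hl : 0 < l) :
    μ {ω | (∃ n, β * l < ‖∑ a ∈ Finset.range n, d a ω‖) ∧
        ∀ n, ∑ a ∈ Finset.range n, ‖d a ω‖ ^ p ≤ (δ * l) ^ p}
      ≤ ENNReal.ofReal (2 * Real.exp (-((β - 1 - δ) ^ p) / (K * δ ^ p))) *
        μ {ω | ∃ n, l < ‖∑ a ∈ Finset.range n, d a ω‖} := by
  classical
  have hun : {ω | ∃ n, l < ‖∑ a ∈ Finset.range n, d a ω‖} = ⋃ k, E d l k := by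
    ext ω
    simp only [Set.mem_ofPred_eq, Set.mem_iUnion]
    constructor
    · intro h
      refine ⟨Nat.find h, fun i hi => ?_, Nat.find_spec h⟩
      exact not_lt.1 (Nat.find_min h hi)
    · rintro ⟨k, hk⟩
      exact ⟨k, hk.2⟩
  have hdisj : Pairwise (Function.onFun Disjoint (E d l)) := by
    have key : ∀ i j, i < j → Disjoint (E d l i) (E d l j) := by
      intro i j hij
      refine Set.disjoint_left.2 fun ω h1 h2 => ?_
      exact absurd h1.2 (not_lt.2 (h2.1 i hij))
    intro i j hij
    rcases lt_or_gt_of_ne hij with h | h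
    · exact key i j h
    · exact (key j i h).symm
  rw [hun, measure_iUnion hdisj fun k => G_le hd _ _ (measurableSet_E hd l k),
    ← ENNReal.tsum_mul_left]
  refine le_trans (measure_mono ?_) ((measure_iUnion_le (fun k => E d l k ∩ _)).trans
    (ENNReal.tsum_le_tsum fun k => block hd hi hs hp hK hX hδ0 hδ hl k))
  intro ω hω
  rw [← Set.iUnion_inter]
  refine ⟨?_, hω⟩
  rw [← hun]
  obtain ⟨⟨n, hn⟩, -⟩ := hω
  exact ⟨n, by nlinarith⟩

/-- Transfer to a probability space living in `Type`. -/
lemma transfer {μ : Measure Ω} [IsProbabilityMeasure μ]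
    {d : ℕ → Ω → X} (hd : ∀ j, StronglyMeasurable (d j)) :
    ∃ (T : Ω → ℝ) (d' : ℕ → ℝ → X), Measurable T ∧ (∀ j, StronglyMeasurable (d' j)) ∧
      ∀ j ω, d' j (T ω) = d j ω := by
  letI : MeasurableSpace X := borel X
  haveI : BorelSpace X := ⟨rfl⟩
  let S : Set X := closure (⋃ j, Set.range (d j))
  have hsep : TopologicalSpace.IsSeparable S :=
    (TopologicalSpace.IsSeparable.iUnion fun j => (hd j).isSeparable_range).closure
  haveI : TopologicalSpace.SeparableSpace S := hsep.separableSpace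
  haveI : CompleteSpace S := isClosed_closure.completeSpace_coe
  haveI : SecondCountableTopology S := UniformSpace.secondCountable_of_separable S
  haveI : PolishSpace S := inferInstance
  let D : Ω → ℕ → S := fun ω j => ⟨d j ω, subset_closure (Set.mem_iUnion.2 ⟨j, ω, rfl⟩)⟩
  have hD : Measurable D :=
    measurable_pi_lambda _ fun j => (hd j).measurable.subtype_mk
  obtain ⟨ω₀⟩ : Nonempty Ω := nonempty_of_isProbabilityMeasure μ
  haveI : Nonempty (ℕ → S) := ⟨D ω₀⟩
  have he := measurableEmbedding_embeddingReal (ℕ → S)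
  obtain ⟨q, hq, hqe⟩ := he.exists_measurable_extend measurable_id fun _ => inferInstance
  refine ⟨fun ω => embeddingReal (ℕ → S) (D ω), fun j x => (q x j : X),
    he.measurable.comp hD, fun j => ?_, fun j ω => ?_⟩
  · exact continuous_subtype_val.comp_stronglyMeasurable
      ((measurable_pi_apply j).comp hq).stronglyMeasurable
  · have := congrFun hqe (D ω)
    simp only [Function.comp, id] at this
    simp [this, D]

lemma good_sums' {μ : Measure Ω} [IsProbabilityMeasure μ]
    {d : ℕ → Ω → X} (hd : ∀ j, StronglyMeasurable (d j))
    (hi : ∀ j, Integrable (d j) μ) (hs : Symm μ d) {p K : ℝ} (hp : 0 < p) (hK : 0 < K)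
    (hX : HasAzumaType X p K)
    {β δ l : ℝ} (hδ0 : 0 < δ) (hδ : δ < β - 1) (hl : 0 < l) :
    μ {ω | (∃ n, β * l < ‖∑ a ∈ Finset.range n, d a ω‖) ∧
        ∀ n, ∑ a ∈ Finset.range n, ‖d a ω‖ ^ p ≤ (δ * l) ^ p}
      ≤ ENNReal.ofReal (2 * Real.exp (-((β - 1 - δ) ^ p) / (K * δ ^ p))) *
        μ {ω | ∃ n, l < ‖∑ a ∈ Finset.range n, d a ω‖} := by
  obtain ⟨T, d', hT, hd', hdd⟩ := transfer (μ := μ) hd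
  haveI := Measure.isProbabilityMeasure_map (μ := μ) hT.aemeasurable
  have hV : ∀ j ω, V d' j (T ω) = V d j ω := fun j ω => funext fun i => hdd i ω
  have hs' : Symm (μ.map T) d' := by
    intro j φ hφ hb
    have hVs := stronglyMeasurable_V hd' j
    rw [integral_map hT.aemeasurable (hφ.comp_stronglyMeasurable hVs).aestronglyMeasurable,
      integral_map (f := fun x => φ (R j (V d' j x))) hT.aemeasurable
        ((hφ.comp (continuous_R j)).comp_stronglyMeasurable hVs).aestronglyMeasurable]
    simp_rw [hV]
    exact hs j φ hφ hb
  have hi' : ∀ j, Integrable (d' j) (μ.map T) := by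
    intro j
    rw [integrable_map_measure (hd' j).aestronglyMeasurable hT.aemeasurable]
    refine (hi j).congr (ae_of_all _ fun ω => (hdd j ω).symm)
  have h := good_sums hd' hi' hs' hp hK hX hδ0 hδ hl
  have hm : MeasurableSet {x | ∃ n, l < ‖∑ a ∈ Finset.range n, d' a x‖} := by
    have : {x | ∃ n, l < ‖∑ a ∈ Finset.range n, d' a x‖}
      = ⋃ n, {x | l < ‖∑ a ∈ Finset.range n, d' a x‖} := by
      ext x
      simp
    rw [this]
    refine MeasurableSet.iUnion fun n => ?_
    exact (Finset.stronglyMeasurable_fun_sum _ fun a _ => hd' a).norm.measurable measurableSet_Ioi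
  rw [Measure.map_apply hT hm] at h
  have h2 := (Measure.le_map_apply hT.aemeasurable _).trans h
  simpa only [Set.preimage_ofPred_eq, hdd] using h2

end GoodLambda

theorem good_lambda_inequality
    {Ω X : Type*} {m : MeasurableSpace Ω} {μ : Measure Ω} [IsProbabilityMeasure μ]
    [NormedAddCommGroup X] [NormedSpace ℝ X] [CompleteSpace X]
    (p K : ℝ) (hp1 : 1 < p) (hp2 : p ≤ 2) (hK : 0 < K)
    (hX : HasAzumaType X p K)
    (ℱ : Filtration ℕ m) (hℱ0 : ℱ 0 = ⊥)
    (f : ℕ → Ω → X) (hf : Martingale f ℱ μ)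
    (hsymm : CondSymmetric μ f)
    (β δ l : ℝ) (hβ : 0 < β) (hδ0 : 0 < δ) (hδ : δ < β - 1) (hl : 0 < l) :
    μ {ω | ENNReal.ofReal (β * l) < (⨆ j : ℕ, (‖f (j + 1) ω - f 0 ω‖₊ : ℝ≥0∞)) ∧
           (∑' j : ℕ, ENNReal.ofReal (‖f (j + 1) ω - f j ω‖ ^ p)) ^ (1 / p)
             ≤ ENNReal.ofReal (δ * l)}
      ≤ ENNReal.ofReal (2 * Real.exp (-((β - 1 - δ) ^ p) / (K * δ ^ p))) *
          μ {ω | ENNReal.ofReal l < ⨆ j : ℕ, (‖f (j + 1) ω - f 0 ω‖₊ : ℝ≥0∞)} := by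
  have hp : 0 < p := by linarith
  have hfm : ∀ j, StronglyMeasurable (f j) := fun j => (hf.1 j).mono (ℱ.le j)
  have hsum : ∀ n ω, ∑ a ∈ Finset.range n, (f (a + 1) ω - f a ω) = f n ω - f 0 ω := by
    intro n ω
    exact Finset.sum_range_sub (fun a => f a ω) n
  have hs : GoodLambda.Symm μ (fun j ω => f (j + 1) ω - f j ω) := fun j φ hφ hb =>
    hsymm j φ hφ hb
  have h := GoodLambda.good_sums' (d := fun j ω => f (j + 1) ω - f j ω)
    (fun j => (hfm (j + 1)).sub (hfm j))
    (fun j => (hf.integrable (j + 1)).sub (hf.integrable j)) hs hp hK hX hδ0 hδ hl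
  simp only [hsum] at h
  have hset : ∀ {l : ℝ}, 0 ≤ l → ∀ ω,
      (ENNReal.ofReal l < (⨆ j : ℕ, (‖f (j + 1) ω - f 0 ω‖₊ : ℝ≥0∞)) ↔
        ∃ n, l < ‖f n ω - f 0 ω‖) := fun hl ω =>
    GoodLambda.lt_iSup_iff' (fun n => f n ω - f 0 ω) (by simp) hl
  simp only [hset hl.le, hset (mul_nonneg hβ.le hl.le)]
  refine le_trans (measure_mono ?_) h
  rintro ω ⟨h1, h2⟩
  refine ⟨h1, fun n => ?_⟩
  have hdl : 0 ≤ δ * l := by positivity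
  rw [one_div, ENNReal.rpow_inv_le_iff hp, ENNReal.ofReal_rpow_of_nonneg hdl hp.le] at h2
  have h3 := (ENNReal.sum_le_tsum (Finset.range n)).trans h2
  rw [← ENNReal.ofReal_sum_of_nonneg fun j _ => Real.rpow_nonneg (norm_nonneg _) _] at h3
  exact (ENNReal.ofReal_le_ofReal_iff (by positivity)).1 h3
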